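/- Let n > 4 be an integer and p > (n+4)/(n−4). Call a pair (μ, w) with μ > 0 a regular radial solution of the Dirichlet problem if w : [0,1] → ℝ is four times continuously differentiable on [0,1] with w'(0) = w'''(0) = 0, w(r) > 0 for r ∈ [0,1), w(1) = w'(1) = 0, and w''''(r) + (2(n−1)/r)w'''(r) + ((n−1)(n−3)/r²)w''(r) − ((n−1)(n−3)/r³)w'(r) = μ(1+w(r))^p for all r ∈ (0,1). Let Λ := sup{μ > 0 : there exists a regular radial solution (μ, w)}, and assume this set is nonempty and bounded above. Then every regular radial solution (λ, u) satisfies u(r) ≤ (Λ/λ)^{1/(p−1)}·r^{−4/(p−1)} − 1 for all r ∈ (0,1]. -/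

import Mathlib

open Set

/-- A pair `(μ, w)` with `μ > 0` is a regular radial solution of the Dirichlet
problem `Δ²w = μ(1+w)^p` in the unit ball: `w` is `C⁴` on `[0,1]`,
`w'(0) = w'''(0) = 0`, `w > 0` on `[0,1)`, `w(1) = w'(1) = 0`, and the radial
biharmonic equation holds on `(0,1)`. -/
def IsRegularRadialSolution (n : ℕ) (p μ : ℝ) (w : ℝ → ℝ) : Prop :=
  0 < μ ∧ ContDiffOn ℝ 4 w (Icc 0 1) ∧
  iteratedDerivWithin 1 w (Icc 0 1) 0 = 0 ∧
  iteratedDerivWithin 3 w (Icc 0 1) 0 = 0 ∧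
  (∀ r ∈ Ico (0 : ℝ) 1, 0 < w r) ∧
  w 1 = 0 ∧ iteratedDerivWithin 1 w (Icc 0 1) 1 = 0 ∧
  ∀ r ∈ Ioo (0 : ℝ) 1,
    iteratedDerivWithin 4 w (Icc 0 1) r
      + (2 * ((n : ℝ) - 1) / r) * iteratedDerivWithin 3 w (Icc 0 1) r
      + (((n : ℝ) - 1) * ((n : ℝ) - 3) / r ^ 2) * iteratedDerivWithin 2 w (Icc 0 1) r
      - (((n : ℝ) - 1) * ((n : ℝ) - 3) / r ^ 3) * iteratedDerivWithin 1 w (Icc 0 1) r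
    = μ * (1 + w r) ^ p

/-- The radial average `∫₀¹ τ ^ m g(s τ) dτ`. For `s > 0` and `m = n - 1` it equals
`s ^ (-n) ∫₀ˢ t ^ (n - 1) g(t) dt`. -/
noncomputable def radialAverage (m : ℕ) (g : ℝ → ℝ) (s : ℝ) : ℝ :=
  ∫ τ in (0 : ℝ)..1, τ ^ m * g (s * τ)

lemma continuous_radialAverage (m : ℕ) {g : ℝ → ℝ} (hg : Continuous g) :
    Continuous (radialAverage m g) :=
  intervalIntegral.continuous_parametric_intervalIntegral_of_continuous' (by fun_prop) 0 1

lemma radialAverage_zero (m : ℕ) (g : ℝ → ℝ) : radialAverage m g 0 = g 0 / (m + 1) := by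
  simp [radialAverage, integral_pow]
  ring

lemma pow_mul_radialAverage (m : ℕ) (g : ℝ → ℝ) (s : ℝ) :
    s ^ (m + 1) * radialAverage m g s = ∫ t in (0 : ℝ)..s, t ^ m * g t := by
  have h := intervalIntegral.mul_integral_comp_mul_left (f := fun t => t ^ m * g t)
    (a := 0) (b := 1) (c := s)
  simp only [mul_zero, mul_one] at h
  rw [← h, pow_succ', mul_assoc, radialAverage, ← intervalIntegral.integral_const_mul]
  simp only [mul_pow, mul_assoc]

lemma hasDerivAt_mul_radialAverage (m : ℕ) {g : ℝ → ℝ} (hg : Continuous g) (s : ℝ) :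
    HasDerivAt (fun s => s * radialAverage m g s) (g s - m * radialAverage m g s) s := by
  rcases eq_or_ne s 0 with rfl | hs
  · have h1 : g 0 - m * radialAverage m g 0 = radialAverage m g 0 := by
      rw [radialAverage_zero]
      field_simp
      ring
    rw [h1, hasDerivAt_iff_tendsto_slope]
    refine ((continuous_radialAverage m hg).continuousAt.tendsto.mono_left
      nhdsWithin_le_nhds).congr' ?_
    filter_upwards [self_mem_nhdsWithin] with x hx
    have hx' : x ≠ 0 := hx
    simp [slope, hx']
  · have hF : HasDerivAt (fun s => ∫ t in (0 : ℝ)..s, t ^ m * g t) (s ^ m * g s) s :=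
      (show Continuous fun t => t ^ m * g t by fun_prop).integral_hasStrictDerivAt 0 s
        |>.hasDerivAt
    have h1 := hF.div (hasDerivAt_pow m s) (pow_ne_zero m hs)
    have h2 : (s ^ m * g s * s ^ m - (∫ t in (0 : ℝ)..s, t ^ m * g t) * (m * s ^ (m - 1)))
        / (s ^ m) ^ 2 = g s - m * radialAverage m g s := by
      rw [← pow_mul_radialAverage]
      rcases m with _ | m
      · simp
      · simp only [Nat.add_sub_cancel]
        field_simp
        ring
    rw [h2] at h1
    refine h1.congr_of_eventuallyEq ?_
    filter_upwards [isOpen_ne.mem_nhds hs] with x hx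
    have hx' : x ≠ 0 := hx
    simp only [Pi.div_apply]
    rw [← pow_mul_radialAverage]
    field_simp
    ring

lemma hasDerivAt_radialAverage (m : ℕ) {g g' : ℝ → ℝ} (hg : ∀ s, HasDerivAt g (g' s) s)
    (hg' : Continuous g') (s : ℝ) :
    HasDerivAt (radialAverage m g) (radialAverage (m + 1) g' s) s := by
  have hgc : Continuous g := continuous_iff_continuousAt.2 fun x => (hg x).continuousAt
  obtain ⟨C, hC⟩ := (isCompact_Icc (a := -(|s| + 1)) (b := |s| + 1)).exists_bound_of_continuousOn
    hg'.continuousOn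
  refine (intervalIntegral.hasDerivAt_integral_of_dominated_loc_of_deriv_le
    (F := fun s τ => τ ^ m * g (s * τ)) (F' := fun s τ => τ ^ (m + 1) * g' (s * τ))
    (bound := fun _ => C) (Metric.ball_mem_nhds s one_pos) (.of_forall fun x => ?_) ?_ ?_ ?_
    (by simp) ?_).2
  · exact (show Continuous fun τ => τ ^ m * g (x * τ) by fun_prop).aestronglyMeasurable
  · exact (show Continuous fun τ => τ ^ m * g (s * τ) by fun_prop).intervalIntegrable _ _
  · exact (show Continuous fun τ => τ ^ (m + 1) * g' (s * τ) by fun_prop).aestronglyMeasurable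
  · refine .of_forall fun τ hτ x hx => ?_
    rw [uIoc_of_le zero_le_one] at hτ
    have hx1 : |x| ≤ |s| + 1 := by
      have := abs_sub_abs_le_abs_sub x s
      rw [Metric.mem_ball, Real.dist_eq] at hx
      linarith
    have hxτ : |x * τ| ≤ |s| + 1 := by
      rw [abs_mul, abs_of_pos hτ.1]
      exact (mul_le_of_le_one_right (abs_nonneg x) hτ.2).trans hx1
    have h1 : |τ ^ (m + 1)| ≤ 1 := by
      rw [abs_of_nonneg (pow_nonneg hτ.1.le _)]
      exact pow_le_one₀ hτ.1.le hτ.2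
    rw [norm_mul, Real.norm_eq_abs (τ ^ (m + 1))]
    exact (mul_le_of_le_one_left (norm_nonneg _) h1).trans (hC _ (abs_le.1 hxτ))
  · refine .of_forall fun τ _ x _ => ?_
    have h := ((hg (x * τ)).comp x ((hasDerivAt_id x).mul_const τ)).const_mul (τ ^ m)
    exact h.congr_deriv (by ring)

lemma radialAverage_add_mul (m : ℕ) {g g' : ℝ → ℝ} (hg : ∀ s, HasDerivAt g (g' s) s)
    (hg' : Continuous g') (s : ℝ) :
    (m + 1) * radialAverage m g s + s * radialAverage (m + 1) g' s = g s := by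
  have hgc : Continuous g := continuous_iff_continuousAt.2 fun x => (hg x).continuousAt
  have h := (hasDerivAt_mul_radialAverage m hgc s).unique
    ((hasDerivAt_id s).mul (hasDerivAt_radialAverage m hg hg' s))
  simp only [id] at h
  linarith

/-- A sequence whose first five terms are a function on `[0, 1]` and its derivatives, continuous
up to the boundary. -/
structure IsJet (d : ℕ → ℝ → ℝ) : Prop where
  continuousOn : ∀ k ≤ 4, ContinuousOn (d k) (Icc 0 1)
  hasDerivAt : ∀ k < 4, ∀ r ∈ Ioo (0 : ℝ) 1, HasDerivAt (d k) (d (k + 1) r) r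

/-- The radial biharmonic operator in dimension `n` applied to a jet. -/
noncomputable def radialBilaplacian (n : ℕ) (d : ℕ → ℝ → ℝ) (r : ℝ) : ℝ :=
  d 4 r + (2 * ((n : ℝ) - 1) / r) * d 3 r + (((n : ℝ) - 1) * ((n : ℝ) - 3) / r ^ 2) * d 2 r
    - (((n : ℝ) - 1) * ((n : ℝ) - 3) / r ^ 3) * d 1 r

lemma IsJet.sub {d e : ℕ → ℝ → ℝ} (hd : IsJet d) (he : IsJet e) :
    IsJet fun k r => d k r - e k r where
  continuousOn k hk := (hd.continuousOn k hk).sub (he.continuousOn k hk)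
  hasDerivAt k hk r hr := (hd.hasDerivAt k hk r hr).sub (he.hasDerivAt k hk r hr)

lemma IsJet.const_mul {d : ℕ → ℝ → ℝ} (hd : IsJet d) (c : ℝ) : IsJet fun k r => c * d k r where
  continuousOn k hk := continuousOn_const.mul (hd.continuousOn k hk)
  hasDerivAt k hk r hr := (hd.hasDerivAt k hk r hr).const_mul c

lemma radialBilaplacian_sub (n : ℕ) (d e : ℕ → ℝ → ℝ) (r : ℝ) :
    radialBilaplacian n (fun k r => d k r - e k r) r
      = radialBilaplacian n d r - radialBilaplacian n e r := by
  simp only [radialBilaplacian]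
  ring

lemma radialBilaplacian_const_mul (n : ℕ) (c : ℝ) (d : ℕ → ℝ → ℝ) (r : ℝ) :
    radialBilaplacian n (fun k r => c * d k r) r = c * radialBilaplacian n d r := by
  simp only [radialBilaplacian]
  ring

/-- A radial function with nonnegative bilaplacian on the unit ball is radially nonincreasing
as soon as its normal derivative on the boundary is nonpositive. -/
lemma IsJet.deriv_nonpos {n : ℕ} (hn : 4 < n) {d : ℕ → ℝ → ℝ} (hd : IsJet d)
    (hΔ : ∀ r ∈ Ioo (0 : ℝ) 1, 0 ≤ radialBilaplacian n d r) (h1 : d 1 1 ≤ 0) :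
    ∀ r ∈ Ioo (0 : ℝ) 1, d 1 r ≤ 0 := by
  obtain ⟨k, rfl⟩ : ∃ k, n = k + 4 := ⟨n - 4, by omega⟩
  have hflux : ∀ r ∈ Icc (0 : ℝ) 1,
      0 ≤ r ^ (k + 3) * d 3 r + (k + 3) * (r ^ (k + 2) * d 2 r)
        - (k + 3) * (r ^ (k + 1) * d 1 r) := by
    have hderiv : ∀ r ∈ Ioo (0 : ℝ) 1,
        HasDerivAt (fun r => r ^ (k + 3) * d 3 r + (k + 3) * (r ^ (k + 2) * d 2 r)
          - (k + 3) * (r ^ (k + 1) * d 1 r)) (r ^ (k + 3) * radialBilaplacian (k + 4) d r) r := by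
      intro r hr
      have h := (((hasDerivAt_pow (k + 3) r).mul (hd.hasDerivAt 3 (by norm_num) r hr)).add
        (((hasDerivAt_pow (k + 2) r).mul (hd.hasDerivAt 2 (by norm_num) r hr)).const_mul
          ((k : ℝ) + 3))).sub
        (((hasDerivAt_pow (k + 1) r).mul (hd.hasDerivAt 1 (by norm_num) r hr)).const_mul
          ((k : ℝ) + 3))
      have hr0 : r ≠ 0 := hr.1.ne'
      refine h.congr_deriv ?_
      simp only [radialBilaplacian]
      push_cast
      field_simp
      ring
    have hmono : MonotoneOn (fun r => r ^ (k + 3) * d 3 r + (k + 3) * (r ^ (k + 2) * d 2 r)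
          - (k + 3) * (r ^ (k + 1) * d 1 r)) (Icc 0 1) := by
      refine monotoneOn_of_deriv_nonneg (convex_Icc 0 1) ?_ ?_ ?_
      · have c1 := hd.continuousOn 1 (by norm_num)
        have c2 := hd.continuousOn 2 (by norm_num)
        have c3 := hd.continuousOn 3 (by norm_num)
        fun_prop
      · rw [interior_Icc]
        exact fun r hr => (hderiv r hr).differentiableAt.differentiableWithinAt
      · rw [interior_Icc]
        intro r hr
        rw [(hderiv r hr).deriv]
        exact mul_nonneg (pow_nonneg hr.1.le _) (hΔ r hr)
    intro r hr
    simpa using hmono (left_mem_Icc.2 zero_le_one) hr hr.1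
  have hlap : MonotoneOn (fun r => d 2 r + (k + 3) * (d 1 r / r)) (Ioo 0 1) := by
    have hderiv : ∀ r ∈ Ioo (0 : ℝ) 1, HasDerivAt (fun r => d 2 r + (k + 3) * (d 1 r / r))
        (d 3 r + (k + 3) * ((d 2 r * r - d 1 r * 1) / r ^ 2)) r := fun r hr =>
      (hd.hasDerivAt 2 (by norm_num) r hr).add
        (((hd.hasDerivAt 1 (by norm_num) r hr).div (hasDerivAt_id r) hr.1.ne').const_mul
          ((k : ℝ) + 3))
    refine monotoneOn_of_deriv_nonneg (convex_Ioo 0 1)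
      (fun r hr => (hderiv r hr).continuousAt.continuousWithinAt) ?_ ?_
    · rw [interior_Ioo]
      exact fun r hr => (hderiv r hr).differentiableAt.differentiableWithinAt
    · rw [interior_Ioo]
      intro r hr
      have hr0 : r ≠ 0 := hr.1.ne'
      rw [(hderiv r hr).deriv]
      refine (div_nonneg (hflux r ⟨hr.1.le, hr.2.le⟩) (pow_nonneg hr.1.le (k + 3))).trans_eq ?_
      field_simp
      ring
  have hg : ∀ r ∈ Ioo (0 : ℝ) 1, HasDerivAt (fun r => r ^ (k + 3) * d 1 r)
      (r ^ (k + 3) * (d 2 r + (k + 3) * (d 1 r / r))) r := by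
    intro r hr
    have hr0 : r ≠ 0 := hr.1.ne'
    refine ((hasDerivAt_pow (k + 3) r).mul (hd.hasDerivAt 1 (by norm_num) r hr)).congr_deriv ?_
    push_cast
    field_simp
    ring
  have hgc : ContinuousOn (fun r => r ^ (k + 3) * d 1 r) (Icc 0 1) := by
    have c1 := hd.continuousOn 1 (by norm_num)
    fun_prop
  intro r hr
  by_contra! hpos
  have hgpos : 0 < r ^ (k + 3) * d 1 r := mul_pos (pow_pos hr.1 _) hpos
  obtain ⟨ξ, hξ, hξ'⟩ := exists_hasDerivAt_eq_slope _ _ hr.1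
    (hgc.mono (Icc_subset_Icc_right hr.2.le)) (fun x hx => hg x ⟨hx.1, hx.2.trans hr.2⟩)
  obtain ⟨η, hη, hη'⟩ := exists_hasDerivAt_eq_slope _ _ hr.2
    (hgc.mono (Icc_subset_Icc_left hr.1.le)) (fun x hx => hg x ⟨hr.1.trans hx.1, hx.2⟩)
  have hη0 : 0 < η := hr.1.trans hη.1
  have hVξ : 0 < d 2 ξ + (k + 3) * (d 1 ξ / ξ) := by
    refine pos_of_mul_pos_right (a := ξ ^ (k + 3)) ?_ (pow_nonneg hξ.1.le _)
    rw [hξ']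
    refine div_pos ?_ (sub_pos.2 hr.1)
    simpa using hgpos
  have hVη : d 2 η + (k + 3) * (d 1 η / η) < 0 := by
    refine neg_of_mul_neg_right (a := η ^ (k + 3)) ?_ (pow_nonneg hη0.le _)
    rw [hη']
    refine div_neg_of_neg_of_pos ?_ (sub_pos.2 hr.2)
    simp only [one_pow, one_mul]
    linarith
  have := hlap ⟨hξ.1, hξ.2.trans hr.2⟩ ⟨hη0, hη.2⟩ (hξ.2.trans hη.1).le
  simp only at this
  linarith

lemma IsJet.antitoneOn {n : ℕ} (hn : 4 < n) {d : ℕ → ℝ → ℝ} (hd : IsJet d)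
    (hΔ : ∀ r ∈ Ioo (0 : ℝ) 1, 0 ≤ radialBilaplacian n d r) (h1 : d 1 1 ≤ 0) :
    AntitoneOn (d 0) (Icc 0 1) := by
  refine antitoneOn_of_deriv_nonpos (convex_Icc 0 1) (hd.continuousOn 0 (by norm_num)) ?_ ?_
  · rw [interior_Icc]
    exact fun r hr =>
      (hd.hasDerivAt 0 (by norm_num) r hr).differentiableAt.differentiableWithinAt
  · rw [interior_Icc]
    intro r hr
    rw [(hd.hasDerivAt 0 (by norm_num) r hr).deriv]
    exact hd.deriv_nonpos hn hΔ h1 r hr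

/-- Comparison principle for the Dirichlet problem, for radial functions. -/
lemma IsJet.le_of_radialBilaplacian_le {n : ℕ} (hn : 4 < n) {d e : ℕ → ℝ → ℝ} (hd : IsJet d)
    (he : IsJet e)
    (hΔ : ∀ r ∈ Ioo (0 : ℝ) 1, radialBilaplacian n d r ≤ radialBilaplacian n e r)
    (h0 : d 0 1 ≤ e 0 1) (h1 : e 1 1 ≤ d 1 1) :
    AntitoneOn (fun r => e 0 r - d 0 r) (Icc 0 1) ∧ ∀ r ∈ Icc (0 : ℝ) 1, d 0 r ≤ e 0 r := by
  have h : AntitoneOn (fun r => e 0 r - d 0 r) (Icc 0 1) :=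
    (he.sub hd).antitoneOn hn
      (fun r hr => by rw [radialBilaplacian_sub]; exact sub_nonneg.2 (hΔ r hr)) (by simpa using h1)
  refine ⟨h, fun r hr => ?_⟩
  have := h hr (right_mem_Icc.2 zero_le_one) hr.2
  simp only at this
  linarith

/-- A jet on the whole line whose restriction to `[0, 1]` is a smooth radial solution of
`Δ²w = f` in the unit ball of dimension `n` with homogeneous Dirichlet boundary conditions. -/
structure IsDirichletSolution (n : ℕ) (f : ℝ → ℝ) (d : ℕ → ℝ → ℝ) : Prop where
  hasDerivAt : ∀ k < 4, ∀ r, HasDerivAt (d k) (d (k + 1) r) r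
  continuous_four : Continuous (d 4)
  one_zero : d 1 0 = 0
  three_zero : d 3 0 = 0
  zero_one : d 0 1 = 0
  one_one : d 1 1 = 0
  radialBilaplacian_eq : ∀ r ∈ Ioo (0 : ℝ) 1, radialBilaplacian n d r = f r

lemma IsDirichletSolution.continuous {n : ℕ} {f : ℝ → ℝ} {d : ℕ → ℝ → ℝ}
    (h : IsDirichletSolution n f d) {k : ℕ} (hk : k ≤ 4) : Continuous (d k) := by
  rcases hk.lt_or_eq with hk | rfl
  · exact continuous_iff_continuousAt.2 fun r => (h.hasDerivAt k hk r).continuousAt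
  · exact h.continuous_four

lemma IsDirichletSolution.isJet {n : ℕ} {f : ℝ → ℝ} {d : ℕ → ℝ → ℝ}
    (h : IsDirichletSolution n f d) : IsJet d where
  continuousOn _ hk := (h.continuous hk).continuousOn
  hasDerivAt k hk r _ := h.hasDerivAt k hk r

lemma exists_isDirichletSolution {n : ℕ} (hn : 0 < n) {f : ℝ → ℝ} (hf : Continuous f) :
    ∃ d, IsDirichletSolution n f d := by
  obtain ⟨m, rfl⟩ : ∃ m, n = m + 1 := ⟨n - 1, by omega⟩
  set V₁ : ℝ → ℝ := fun s => s * radialAverage m f s with hV₁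
  set V₂ : ℝ → ℝ := fun s => f s - m * radialAverage m f s with hV₂
  set V : ℝ → ℝ := fun r => ∫ s in (0 : ℝ)..r, V₁ s with hV
  have hV₁c : Continuous V₁ := continuous_id.mul (continuous_radialAverage m hf)
  have hV₂c : Continuous V₂ := hf.sub (continuous_const.mul (continuous_radialAverage m hf))
  have hdV : ∀ r, HasDerivAt V (V₁ r) r := fun r =>
    (hV₁c.integral_hasStrictDerivAt 0 r).hasDerivAt
  have hdV₁ : ∀ r, HasDerivAt V₁ (V₂ r) r := hasDerivAt_mul_radialAverage m hf
  have hVc : Continuous V := continuous_iff_continuousAt.2 fun r => (hdV r).continuousAt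
  have hWc : Continuous fun s => s * radialAverage m V s :=
    continuous_id.mul (continuous_radialAverage m hVc)
  set α := radialAverage m V 1
  let d : ℕ → ℝ → ℝ := fun k => match k with
    | 0 => fun r => (∫ s in (1 : ℝ)..r, s * radialAverage m V s) - α * ((r ^ 2 - 1) / 2)
    | 1 => fun r => r * radialAverage m V r - α * r
    | 2 => fun r => V r - m * radialAverage m V r - α
    | 3 => fun r => V₁ r - m * radialAverage (m + 1) V₁ r
    | _ => fun r => V₂ r - m * radialAverage (m + 2) V₂ r
  refine ⟨d, ?_, ?_, ?_, ?_, ?_, ?_, ?_⟩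
  · intro k hk r
    interval_cases k
    · refine ((hWc.integral_hasStrictDerivAt 1 r).hasDerivAt.sub
        ((((hasDerivAt_pow 2 r).sub_const 1).div_const 2).const_mul α)).congr_deriv ?_
      simp [d]
    · exact ((hasDerivAt_mul_radialAverage m hVc r).sub
        ((hasDerivAt_id r).const_mul α)).congr_deriv (by simp [d])
    · exact ((hdV r).sub ((hasDerivAt_radialAverage m hdV hV₁c r).const_mul _)).sub_const α
    · exact (hdV₁ r).sub ((hasDerivAt_radialAverage (m + 1) hdV₁ hV₂c r).const_mul _)
  · exact hV₂c.sub (continuous_const.mul (continuous_radialAverage _ hV₂c))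
  · simp [d]
  · simp [d, radialAverage_zero, hV₁]
  · simp [d]
  · simp [d, α]
  · intro r hr
    have hr0 : r ≠ 0 := hr.1.ne'
    have e₁ := radialAverage_add_mul m hdV hV₁c r
    have e₂ := radialAverage_add_mul (m + 1) hdV₁ hV₂c r
    have e₃ : f r = V₂ r + m * V₁ r / r := by
      simp only [hV₁, hV₂]
      field_simp
      ring
    simp only [radialBilaplacian, d]
    rw [e₃, ← e₁, ← e₂]
    push_cast
    field_simp
    ring

/-- The jet of `(1 - r²)² / (8n(n + 2))`, the solution of the Dirichlet problem for `Δ²w = 1`. -/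
noncomputable def clampedPlate (n : ℕ) : ℕ → ℝ → ℝ
  | 0 => fun r => (1 - 2 * r ^ 2 + r ^ 4) / (8 * n * (n + 2))
  | 1 => fun r => (-4 * r + 4 * r ^ 3) / (8 * n * (n + 2))
  | 2 => fun r => (-4 + 12 * r ^ 2) / (8 * n * (n + 2))
  | 3 => fun r => 24 * r / (8 * n * (n + 2))
  | _ => fun _ => 24 / (8 * n * (n + 2))

lemma isDirichletSolution_clampedPlate {n : ℕ} (hn : 0 < n) :
    IsDirichletSolution n (fun _ => 1) (clampedPlate n) := by
  refine ⟨?_, continuous_const, ?_, ?_, ?_, ?_, ?_⟩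
  · intro k hk r
    interval_cases k
    · exact ((((hasDerivAt_pow 2 r).const_mul 2).const_sub 1).add
        (hasDerivAt_pow 4 r)).div_const _ |>.congr_deriv (by simp [clampedPlate]; ring)
    · exact (((hasDerivAt_id r).const_mul (-4)).add
        ((hasDerivAt_pow 3 r).const_mul 4)).div_const _ |>.congr_deriv
          (by simp [clampedPlate]; ring)
    · exact (((hasDerivAt_pow 2 r).const_mul 12).const_add (-4)).div_const _ |>.congr_deriv
        (by simp [clampedPlate]; ring)
    · exact ((hasDerivAt_id r).const_mul 24).div_const _ |>.congr_deriv
        (by simp [clampedPlate])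
  · simp [clampedPlate]
  · simp [clampedPlate]
  · simp [clampedPlate]; norm_num
  · simp [clampedPlate]
  · intro r hr
    have hr0 : r ≠ 0 := hr.1.ne'
    have hn0 : (n : ℝ) ≠ 0 := by positivity
    have hn2 : (n : ℝ) + 2 ≠ 0 := by positivity
    simp only [radialBilaplacian, clampedPlate]
    field_simp
    ring

lemma clampedPlate_pos {n : ℕ} (hn : 0 < n) {r : ℝ} (hr : r ∈ Ico (0 : ℝ) 1) :
    0 < clampedPlate n 0 r := by
  have h : 0 < 1 - r ^ 2 := by nlinarith [hr.1, hr.2]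
  simp only [clampedPlate]
  rw [show 1 - 2 * r ^ 2 + r ^ 4 = (1 - r ^ 2) ^ 2 by ring]
  positivity

lemma clampedPlate_nonneg (n : ℕ) (r : ℝ) : 0 ≤ clampedPlate n 0 r := by
  simp only [clampedPlate]
  rw [show 1 - 2 * r ^ 2 + r ^ 4 = (1 - r ^ 2) ^ 2 by ring]
  positivity

lemma IsDirichletSolution.iteratedDerivWithin_eq {n : ℕ} {f : ℝ → ℝ} {d : ℕ → ℝ → ℝ}
    (h : IsDirichletSolution n f d) {k : ℕ} (hk : k ≤ 4) :
    ∀ r ∈ Icc (0 : ℝ) 1, iteratedDerivWithin k (d 0) (Icc 0 1) r = d k r := by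
  induction k with
  | zero => simp
  | succ k ih =>
    intro r hr
    rw [iteratedDerivWithin_succ, derivWithin_congr (ih (by omega)) (ih (by omega) r hr)]
    exact (h.hasDerivAt k (by omega) r).hasDerivWithinAt.derivWithin
      (uniqueDiffOn_Icc zero_lt_one r hr)

lemma IsDirichletSolution.contDiffOn {n : ℕ} {f : ℝ → ℝ} {d : ℕ → ℝ → ℝ}
    (h : IsDirichletSolution n f d) : ContDiffOn ℝ 4 (d 0) (Icc 0 1) := by
  refine contDiffOn_of_continuousOn_differentiableOn_deriv (n := 4) (fun k hk => ?_)
    (fun k hk => ?_)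
  · have hk' : k ≤ 4 := by exact_mod_cast hk
    exact (h.continuous hk').continuousOn.congr (h.iteratedDerivWithin_eq hk')
  · have hk' : k < 4 := by exact_mod_cast hk
    exact DifferentiableOn.congr
      (fun r _ => (h.hasDerivAt k hk' r).differentiableAt.differentiableWithinAt)
      (h.iteratedDerivWithin_eq hk'.le)

lemma IsDirichletSolution.isRegularRadialSolution {n : ℕ} {p μ : ℝ} {f : ℝ → ℝ}
    {d : ℕ → ℝ → ℝ} (h : IsDirichletSolution n f d) (hμ : 0 < μ)
    (hpos : ∀ r ∈ Ico (0 : ℝ) 1, 0 < d 0 r)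
    (hf : ∀ r ∈ Ioo (0 : ℝ) 1, f r = μ * (1 + d 0 r) ^ p) :
    IsRegularRadialSolution n p μ (d 0) := by
  have h0 : (0 : ℝ) ∈ Icc (0 : ℝ) 1 := left_mem_Icc.2 zero_le_one
  have h1 : (1 : ℝ) ∈ Icc (0 : ℝ) 1 := right_mem_Icc.2 zero_le_one
  refine ⟨hμ, h.contDiffOn, ?_, ?_, hpos, h.zero_one, ?_, fun r hr => ?_⟩
  · rw [h.iteratedDerivWithin_eq (by norm_num) 0 h0, h.one_zero]
  · rw [h.iteratedDerivWithin_eq (by norm_num) 0 h0, h.three_zero]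
  · rw [h.iteratedDerivWithin_eq (by norm_num) 1 h1, h.one_one]
  · have hr' := Ioo_subset_Icc_self hr
    rw [h.iteratedDerivWithin_eq (by norm_num) r hr', h.iteratedDerivWithin_eq (by norm_num) r hr',
      h.iteratedDerivWithin_eq (by norm_num) r hr', h.iteratedDerivWithin_eq (by norm_num) r hr',
      ← hf r hr]
    exact h.radialBilaplacian_eq r hr

open Filter Topology in
/-- The sub- and supersolution method: a nonnegative radial supersolution of the Dirichlet problem
yields a regular radial solution with the same parameter. -/
lemma exists_isRegularRadialSolution_of_supersolution {n : ℕ} (hn : 4 < n) {p μ : ℝ}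
    (hp : 0 ≤ p) (hμ : 0 < μ) {d : ℕ → ℝ → ℝ} (hd : IsJet d)
    (hnonneg : ∀ r ∈ Icc (0 : ℝ) 1, 0 ≤ d 0 r) (h1 : d 1 1 ≤ 0)
    (hΔ : ∀ r ∈ Ioo (0 : ℝ) 1, μ * (1 + d 0 r) ^ p ≤ radialBilaplacian n d r) :
    ∃ w, IsRegularRadialSolution n p μ w := by
  have hn0 : 0 < n := by omega
  have hr1 : (1 : ℝ) ∈ Icc (0 : ℝ) 1 := right_mem_Icc.2 zero_le_one
  have hq := isDirichletSolution_clampedPlate hn0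
  let φ : ℝ → ℝ := fun t => μ * (1 + max t 0) ^ p
  have hφc : Continuous φ :=
    continuous_const.mul ((by fun_prop : Continuous fun t : ℝ => 1 + max t 0).rpow_const
      fun _ => Or.inr hp)
  have hφm : Monotone φ := fun s t hst => by
    have : max s 0 ≤ max t 0 := max_le_max_right 0 hst
    have h0 : 0 ≤ 1 + max s 0 := by positivity
    exact mul_le_mul_of_nonneg_left (Real.rpow_le_rpow h0 (by linarith) hp) hμ.le
  have hφμ : ∀ t, μ ≤ φ t := fun t =>
    le_mul_of_one_le_right hμ.le (Real.one_le_rpow (by linarith [le_max_right t 0]) hp)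
  have hφ_of_nonneg : ∀ t, 0 ≤ t → φ t = μ * (1 + t) ^ p := fun t ht => by
    simp only [φ, max_eq_left ht]
  have hex : ∀ f : ℝ → ℝ, ∃ z, Continuous f → IsDirichletSolution n f z := fun f => by
    by_cases hf : Continuous f
    · exact (exists_isDirichletSolution hn0 hf).imp fun _ h _ => h
    · exact ⟨fun _ _ => 0, fun h => absurd h hf⟩
  choose S hS using hex
  let v : ℕ → ℝ → ℝ := fun k => Nat.rec (fun _ => 0) (fun _ w => S (φ ∘ w) 0) k
  have hv_succ : ∀ k, v (k + 1) = S (φ ∘ v k) 0 := fun k => rfl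
  have hvc : ∀ k, Continuous (v k) := by
    intro k
    induction k with
    | zero => exact continuous_const
    | succ k ih => exact (hS _ (hφc.comp ih)).continuous (by norm_num)
  have hSv : ∀ k, IsDirichletSolution n (φ ∘ v k) (S (φ ∘ v k)) := fun k =>
    hS _ (hφc.comp (hvc k))
  have hlower : ∀ {f : ℝ → ℝ} {z : ℕ → ℝ → ℝ}, (∀ r, μ ≤ f r) → IsDirichletSolution n f z →
      ∀ r ∈ Icc (0 : ℝ) 1, μ * clampedPlate n 0 r ≤ z 0 r := fun {f z} hf hz =>
    ((hq.isJet.const_mul μ).le_of_radialBilaplacian_le hn hz.isJet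
      (fun r hr => by
        rw [radialBilaplacian_const_mul, hq.radialBilaplacian_eq r hr,
          hz.radialBilaplacian_eq r hr, mul_one]
        exact hf r)
      (by rw [hq.zero_one, hz.zero_one, mul_zero])
      (by rw [hq.one_one, hz.one_one, mul_zero])).2
  have hv_step : ∀ k, ∀ r ∈ Icc (0 : ℝ) 1, v k r ≤ v (k + 1) r := by
    intro k
    induction k with
    | zero =>
      exact fun r hr => (mul_nonneg hμ.le (clampedPlate_nonneg n r)).trans
        (hlower (fun r => hφμ (v 0 r)) (hSv 0) r hr)
    | succ k ih =>
      refine ((hSv k).isJet.le_of_radialBilaplacian_le hn (hSv (k + 1)).isJet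
        (fun r hr => ?_) ?_ ?_).2
      · rw [(hSv k).radialBilaplacian_eq r hr, (hSv (k + 1)).radialBilaplacian_eq r hr]
        exact hφm (ih r (Ioo_subset_Icc_self hr))
      · rw [(hSv k).zero_one, (hSv (k + 1)).zero_one]
      · rw [(hSv k).one_one, (hSv (k + 1)).one_one]
  have hv_mono : ∀ r ∈ Icc (0 : ℝ) 1, Monotone fun k => v k r := fun r hr =>
    monotone_nat_of_le_succ fun k => hv_step k r hr
  have hv_le : ∀ k, ∀ r ∈ Icc (0 : ℝ) 1, v k r ≤ d 0 r := by
    intro k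
    induction k with
    | zero => exact hnonneg
    | succ k ih =>
      refine ((hSv k).isJet.le_of_radialBilaplacian_le hn hd (fun r hr => ?_) ?_ ?_).2
      · have hr' := Ioo_subset_Icc_self hr
        rw [(hSv k).radialBilaplacian_eq r hr]
        refine (hφm (ih r hr')).trans ?_
        rw [hφ_of_nonneg _ (hnonneg r hr')]
        exact hΔ r hr
      · rw [(hSv k).zero_one]
        exact hnonneg 1 hr1
      · rw [(hSv k).one_one]
        exact h1
  obtain ⟨B, hB⟩ := (isCompact_Icc (a := (0 : ℝ)) (b := 1)).exists_bound_of_continuousOn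
    (hd.continuousOn 0 (by norm_num))
  have hv_osc : ∀ k, ∀ x ∈ Icc (0 : ℝ) 1, ∀ y ∈ Icc (0 : ℝ) 1,
      |v (k + 1) x - v (k + 1) y| ≤ φ B * |clampedPlate n 0 x - clampedPlate n 0 y| := by
    intro k
    have hanti : AntitoneOn (v (k + 1)) (Icc 0 1) := (hSv k).isJet.antitoneOn hn
      (fun r hr => by
        rw [(hSv k).radialBilaplacian_eq r hr]
        exact hμ.le.trans (hφμ _)) (hSv k).one_one.le
    have hanti' := ((hSv k).isJet.le_of_radialBilaplacian_le hn (hq.isJet.const_mul (φ B))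
      (fun r hr => by
        have hr' := Ioo_subset_Icc_self hr
        rw [radialBilaplacian_const_mul, hq.radialBilaplacian_eq r hr,
          (hSv k).radialBilaplacian_eq r hr, mul_one]
        exact hφm ((hv_le k r hr').trans ((le_abs_self _).trans (hB r hr'))))
      (by rw [hq.zero_one, (hSv k).zero_one, mul_zero])
      (by rw [hq.one_one, (hSv k).one_one, mul_zero])).1
    have hle : ∀ x ∈ Icc (0 : ℝ) 1, ∀ y ∈ Icc (0 : ℝ) 1, x ≤ y →
        |v (k + 1) x - v (k + 1) y| ≤ φ B * |clampedPlate n 0 x - clampedPlate n 0 y| := by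
      intro x hx y hy hxy
      have e₁ := hanti hx hy hxy
      have e₂ := hanti' hx hy hxy
      simp only [← hv_succ] at e₂
      rw [abs_of_nonneg (sub_nonneg.2 e₁)]
      have e₃ := mul_le_mul_of_nonneg_left (le_abs_self (clampedPlate n 0 x - clampedPlate n 0 y))
        (hμ.le.trans (hφμ B))
      linarith
    intro x hx y hy
    rcases le_total x y with hxy | hxy
    · exact hle x hx y hy hxy
    · rw [abs_sub_comm, abs_sub_comm (clampedPlate n 0 x)]
      exact hle y hy x hx hxy
  let w : ℝ → ℝ := fun r => ⨆ k, v k r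
  have hw : ∀ r ∈ Icc (0 : ℝ) 1, Tendsto (fun k => v k r) atTop (𝓝 (w r)) := fun r hr =>
    tendsto_atTop_ciSup (hv_mono r hr) ⟨d 0 r, by rintro _ ⟨k, rfl⟩; exact hv_le k r hr⟩
  have hw' : ∀ r ∈ Icc (0 : ℝ) 1, Tendsto (fun k => v (k + 1) r) atTop (𝓝 (w r)) := fun r hr =>
    (tendsto_add_atTop_iff_nat 1).2 (hw r hr)
  have hv_le_w : ∀ k, ∀ r ∈ Icc (0 : ℝ) 1, v k r ≤ w r := fun k r hr =>
    (hv_mono r hr).ge_of_tendsto (hw r hr) k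
  have hwc : ContinuousOn w (Icc 0 1) := by
    intro x hx
    refine tendsto_iff_norm_sub_tendsto_zero.2 (squeeze_zero' (.of_forall fun _ => norm_nonneg _)
      (g := fun y => φ B * |clampedPlate n 0 y - clampedPlate n 0 x|) ?_ ?_)
    · filter_upwards [self_mem_nhdsWithin] with y hy
      exact le_of_tendsto ((hw' y hy).sub (hw' x hx)).abs
        (.of_forall fun k => hv_osc k y hy x hx)
    · have hc : Continuous fun y => φ B * |clampedPlate n 0 y - clampedPlate n 0 x| := by
        have := hq.continuous (k := 0) (by norm_num)
        fun_prop
      simpa using (hc.tendsto x).mono_left nhdsWithin_le_nhds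
  let W : ℝ → ℝ := fun r => w (projIcc 0 1 zero_le_one r)
  have hWc : Continuous W :=
    hwc.comp_continuous (continuous_subtype_val.comp continuous_projIcc) fun r => Subtype.prop _
  have hWw : ∀ r ∈ Icc (0 : ℝ) 1, W r = w r := fun r hr => by
    simp only [W, projIcc_of_mem zero_le_one hr]
  have hz := hS _ (hφc.comp hWc)
  set z := S (φ ∘ W)
  have hunif : TendstoUniformlyOn (fun k => φ ∘ v k) (φ ∘ W) atTop (Icc 0 1) :=
    Monotone.tendstoUniformlyOn_of_forall_tendsto isCompact_Icc
      (fun k => (hφc.comp (hvc k)).continuousOn) (fun r hr k l hkl => hφm (hv_mono r hr hkl))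
      (hφc.comp hWc).continuousOn
      (fun r hr => by
        simp only [Function.comp, hWw r hr]
        exact (hφc.tendsto _).comp (hw r hr))
  have hzw : ∀ r ∈ Icc (0 : ℝ) 1, z 0 r = w r := by
    intro r hr
    refine le_antisymm ?_ ?_
    · have hε : ∀ ε > 0, z 0 r - ε * clampedPlate n 0 r ≤ w r := by
        intro ε hε
        obtain ⟨k, hk⟩ := (Metric.tendstoUniformlyOn_iff.1 hunif ε hε).exists
        refine le_trans ?_ (hv_le_w (k + 1) r hr)
        refine ((hz.isJet.sub (hq.isJet.const_mul ε)).le_of_radialBilaplacian_le hn (hSv k).isJet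
          (fun s hs => ?_) ?_ ?_).2 r hr
        · rw [radialBilaplacian_sub, radialBilaplacian_const_mul, hq.radialBilaplacian_eq s hs,
            hz.radialBilaplacian_eq s hs, (hSv k).radialBilaplacian_eq s hs]
          have := (le_abs_self _).trans_lt (hk s (Ioo_subset_Icc_self hs))
          linarith
        · rw [hz.zero_one, hq.zero_one, (hSv k).zero_one, mul_zero, sub_zero]
        · rw [hz.one_one, hq.one_one, (hSv k).one_one, mul_zero, sub_zero]
      have hlim : Tendsto (fun ε : ℝ => z 0 r - ε * clampedPlate n 0 r) (𝓝[>] 0) (𝓝 (z 0 r)) := by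
        have hc : Continuous fun ε : ℝ => z 0 r - ε * clampedPlate n 0 r := by fun_prop
        simpa using (hc.tendsto 0).mono_left nhdsWithin_le_nhds
      exact le_of_tendsto hlim (eventually_mem_nhdsWithin.mono hε)
    · refine le_of_tendsto (hw' r hr) (.of_forall fun k => ?_)
      refine ((hSv k).isJet.le_of_radialBilaplacian_le hn hz.isJet (fun s hs => ?_) ?_ ?_).2 r hr
      · have hs' := Ioo_subset_Icc_self hs
        rw [(hSv k).radialBilaplacian_eq s hs, hz.radialBilaplacian_eq s hs]
        simp only [Function.comp, hWw s hs']
        exact hφm (hv_le_w k s hs')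
      · rw [(hSv k).zero_one, hz.zero_one]
      · rw [(hSv k).one_one, hz.one_one]
  refine ⟨z 0, hz.isRegularRadialSolution hμ (fun r hr => ?_) (fun r hr => ?_)⟩
  · exact (mul_pos hμ (clampedPlate_pos hn0 hr)).trans_le
      (hlower (fun r => hφμ (W r)) hz r (Ico_subset_Icc_self hr))
  · have hr' := Ioo_subset_Icc_self hr
    have hz0 : 0 ≤ z 0 r := (mul_nonneg hμ.le (clampedPlate_nonneg n r)).trans
      (hlower (fun r => hφμ (W r)) hz r hr')
    simp only [Function.comp, hWw r hr', ← hzw r hr']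
    exact hφ_of_nonneg _ hz0

lemma ContDiffOn.isJet {u : ℝ → ℝ} (hu : ContDiffOn ℝ 4 u (Icc 0 1)) :
    IsJet fun k => iteratedDerivWithin k u (Icc 0 1) where
  continuousOn k hk :=
    hu.continuousOn_iteratedDerivWithin (by exact_mod_cast hk) (uniqueDiffOn_Icc zero_lt_one)
  hasDerivAt k hk r hr := by
    have hmem : Icc (0 : ℝ) 1 ∈ nhds r := Icc_mem_nhds hr.1 hr.2
    have h := ((hu.differentiableOn_iteratedDerivWithin (by exact_mod_cast hk)
      (uniqueDiffOn_Icc zero_lt_one)).differentiableAt hmem).hasDerivAt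
    rwa [iteratedDerivWithin_succ, derivWithin_of_mem_nhds hmem]

/-- Dilation of a jet. -/
lemma IsJet.dilate {d : ℕ → ℝ → ℝ} (hd : IsJet d) {ρ : ℝ} (hρ : ρ ∈ Ioo (0 : ℝ) 1) :
    IsJet fun k r => ρ ^ k * d k (ρ * r) where
  continuousOn k hk := continuousOn_const.mul ((hd.continuousOn k hk).comp
    (continuous_const.mul continuous_id).continuousOn
    fun r hr => ⟨mul_nonneg hρ.1.le hr.1, mul_le_one₀ hρ.2.le hr.1 hr.2⟩)
  hasDerivAt k hk r hr := by
    have hmem : ρ * r ∈ Ioo (0 : ℝ) 1 :=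
      ⟨mul_pos hρ.1 hr.1, mul_lt_one_of_nonneg_of_lt_one_left hρ.1.le hρ.2 hr.2.le⟩
    have h := ((hd.hasDerivAt k hk _ hmem).comp r
      ((hasDerivAt_id r).const_mul ρ)).const_mul (ρ ^ k)
    exact h.congr_deriv (by ring)

lemma radialBilaplacian_dilate (n : ℕ) (d : ℕ → ℝ → ℝ) {ρ : ℝ} (hρ : ρ ≠ 0) {r : ℝ}
    (hr : r ≠ 0) :
    radialBilaplacian n (fun k r => ρ ^ k * d k (ρ * r)) r
      = ρ ^ 4 * radialBilaplacian n d (ρ * r) := by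
  simp only [radialBilaplacian]
  field_simp

/-- The jet of the constant function with value `c`. -/
def constJet (c : ℝ) : ℕ → ℝ → ℝ
  | 0 => fun _ => c
  | _ => fun _ => 0

lemma isJet_constJet (c : ℝ) : IsJet (constJet c) where
  continuousOn k _ := by cases k <;> exact continuousOn_const
  hasDerivAt k _ r _ := by cases k <;> exact hasDerivAt_const r _

lemma radialBilaplacian_constJet (n : ℕ) (c r : ℝ) : radialBilaplacian n (constJet c) r = 0 := by
  simp [radialBilaplacian, constJet]

/-- Rescaling a regular radial solution to a smaller concentric ball produces a regular radial
solution for a possibly larger parameter. -/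
lemma IsRegularRadialSolution.exists_rescaled {n : ℕ} (hn : 4 < n) {p lam : ℝ} (hp : 0 ≤ p)
    {u : ℝ → ℝ} (hu : IsRegularRadialSolution n p lam u) {ρ : ℝ} (hρ : ρ ∈ Ioo (0 : ℝ) 1) :
    ∃ w, IsRegularRadialSolution n p (lam * ρ ^ 4 * (1 + u ρ) ^ (p - 1)) w := by
  obtain ⟨hlam, hsmooth, -, -, hpos, hu1, hdu1, heq⟩ := hu
  have hr1 : (1 : ℝ) ∈ Icc (0 : ℝ) 1 := right_mem_Icc.2 zero_le_one
  have hd := hsmooth.isJet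
  have hnonneg : ∀ r ∈ Icc (0 : ℝ) 1, 0 ≤ u r := fun r hr => by
    rcases hr.2.lt_or_eq with h | rfl
    · exact (hpos r ⟨hr.1, h⟩).le
    · exact hu1.ge
  set d : ℕ → ℝ → ℝ := fun k => iteratedDerivWithin k u (Icc 0 1)
  have hd0 : d 0 = u := iteratedDerivWithin_zero
  have hΔ : ∀ r ∈ Ioo (0 : ℝ) 1, radialBilaplacian n d r = lam * (1 + u r) ^ p := heq
  have hΔ0 : ∀ r ∈ Ioo (0 : ℝ) 1, 0 ≤ radialBilaplacian n d r := fun r hr => by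
    rw [hΔ r hr]
    have := hnonneg r (Ioo_subset_Icc_self hr)
    positivity
  have hanti : AntitoneOn u (Icc 0 1) := hd0 ▸ hd.antitoneOn hn hΔ0 hdu1.le
  have hρ' := Ioo_subset_Icc_self hρ
  have ha : 0 < 1 + u ρ := by linarith [hnonneg ρ hρ']
  set a := 1 + u ρ with ha_def
  set e : ℕ → ℝ → ℝ := fun k r => a⁻¹ * (ρ ^ k * d k (ρ * r)) - constJet (1 - a⁻¹) k r with he_def
  have he : IsJet e := ((hd.dilate hρ).const_mul a⁻¹).sub (isJet_constJet _)
  have he0 : ∀ r, 1 + e 0 r = (1 + u (ρ * r)) / a := fun r => by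
    simp only [he_def, hd0, constJet]
    field_simp
    ring
  refine exists_isRegularRadialSolution_of_supersolution hn hp
    (mul_pos (mul_pos hlam (pow_pos hρ.1 4)) (Real.rpow_pos_of_pos ha _)) he
    (fun r hr => ?_) ?_ (fun r hr => ?_)
  · have hle : ρ * r ≤ ρ := mul_le_of_le_one_right hρ.1.le hr.2
    have := hanti ⟨mul_nonneg hρ.1.le hr.1, hle.trans hρ.2.le⟩ hρ' hle
    have h1 : 1 ≤ (1 + u (ρ * r)) / a := by
      rw [le_div_iff₀ ha]
      linarith
    linarith [he0 r]
  · have h := hd.deriv_nonpos hn hΔ0 hdu1.le ρ hρ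
    simp only [he_def, constJet, pow_one, mul_one, sub_zero]
    exact mul_nonpos_of_nonneg_of_nonpos (inv_nonneg.2 ha.le)
      (mul_nonpos_of_nonneg_of_nonpos hρ.1.le h)
  · have hmem : ρ * r ∈ Ioo (0 : ℝ) 1 :=
      ⟨mul_pos hρ.1 hr.1, mul_lt_one_of_nonneg_of_lt_one_left hρ.1.le hρ.2 hr.2.le⟩
    have hb : 0 ≤ 1 + u (ρ * r) := by linarith [hnonneg _ (Ioo_subset_Icc_self hmem)]
    rw [he0, radialBilaplacian_sub, radialBilaplacian_constJet, radialBilaplacian_const_mul,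
      radialBilaplacian_dilate n d hρ.1.ne' hr.1.ne', hΔ _ hmem, Real.div_rpow hb ha.le,
      Real.rpow_sub_one ha.ne']
    refine le_of_eq ?_
    have := (Real.rpow_pos_of_pos ha p).ne'
    field_simp
    ring

/-- with `Λ` the supremum of the parameters `μ` admitting a
regular radial solution (assumed nonempty and bounded above), every regular
radial solution `(λ, u)` satisfies
`u(r) ≤ (Λ/λ)^{1/(p−1)} r^{−4/(p−1)} − 1` on `(0,1]`. -/
theorem statement7 (n : ℕ) (hn : 4 < n) (p : ℝ)
    (hp : ((n : ℝ) + 4) / ((n : ℝ) - 4) < p)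
    (Λ : ℝ)
    (hΛ : Λ = sSup {μ : ℝ | ∃ w : ℝ → ℝ, IsRegularRadialSolution n p μ w})
    (hne : {μ : ℝ | ∃ w : ℝ → ℝ, IsRegularRadialSolution n p μ w}.Nonempty)
    (hbdd : BddAbove {μ : ℝ | ∃ w : ℝ → ℝ, IsRegularRadialSolution n p μ w})
    (lam : ℝ) (u : ℝ → ℝ) (hu : IsRegularRadialSolution n p lam u) :
    ∀ r ∈ Ioc (0 : ℝ) 1,
      u r ≤ (Λ / lam) ^ (1 / (p - 1)) * r ^ (-(4 / (p - 1))) - 1 := by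
  have hn' : (4 : ℝ) < n := by exact_mod_cast hn
  have hp1 : 1 < p := lt_trans (by rw [lt_div_iff₀] <;> linarith) hp
  have hlam : 0 < lam := hu.1
  have hΛlam : lam ≤ Λ := hΛ ▸ le_csSup hbdd ⟨u, hu⟩
  intro r hr
  have hp1' : 0 < p - 1 := sub_pos.2 hp1
  rcases hr.2.lt_or_eq with hr1 | rfl
  · have hur : 0 < 1 + u r := by linarith [hu.2.2.2.2.1 r ⟨hr.1.le, hr1⟩]
    have hμ : lam * r ^ 4 * (1 + u r) ^ (p - 1) ≤ Λ :=
      hΛ ▸ le_csSup hbdd (hu.exists_rescaled hn (by linarith) ⟨hr.1, hr1⟩)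
    have hpow : (1 + u r) ^ (p - 1) ≤ Λ / lam * r ^ (-4 : ℝ) := by
      rw [Real.rpow_neg hr.1.le, show (4 : ℝ) = ((4 : ℕ) : ℝ) by norm_num, Real.rpow_natCast,
        ← div_eq_mul_inv, div_div, le_div_iff₀ (mul_pos hlam (pow_pos hr.1 4))]
      linarith
    have hΛ0 : 0 ≤ Λ / lam := div_nonneg (hlam.le.trans hΛlam) hlam.le
    have h := Real.rpow_le_rpow (Real.rpow_nonneg hur.le _) hpow (one_div_pos.2 hp1').le
    rw [← Real.rpow_mul hur.le, mul_one_div_cancel hp1'.ne', Real.rpow_one,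
      Real.mul_rpow hΛ0 (Real.rpow_nonneg hr.1.le _), ← Real.rpow_mul hr.1.le,
      show -4 * (1 / (p - 1)) = -(4 / (p - 1)) by ring] at h
    linarith
  · rw [hu.2.2.2.2.2.1, Real.one_rpow, mul_one, sub_nonneg]
    exact Real.one_le_rpow ((one_le_div hlam).2 hΛlam) (one_div_pos.2 hp1').le
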